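/- arXiv:1506.06422 — 2 statements merged into one kernel-verified Lean document; each statement's English description precedes it below -/
import Mathlib

section
/- Let X be a connected topological space, f : X → ℝ nonnegative and bounded, (X_n) a sequence of finite subsets of X, and 𝒞_n a cluster tree on X_n with height function f restricted to X_n. Suppose the merge distortion converges to zero: sup_{x, x' ∈ X_n} |m_{𝒞_n}(x, x') − m_f(x, x')| → 0 as n → ∞. Then both of the following hold: (uniform minimality) for every δ > 0 there exists N such that for all n ≥ N, every λ, and every connected component A of {f ≥ λ}, the set A ∩ X_n is connected at level λ − δ in (X_n, 𝒞_n, f); and (uniform separation) for every δ > 0 there exists N such that for all n ≥ N, every λ, and any two disjoint connected components A, A' of {f ≥ λ} with μ := inf_{a ∈ A, a' ∈ A'} m_f(a, a'), the sets A ∩ X_n and A' ∩ X_n are separated at level μ + δ in (X_n, 𝒞_n, f). -/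
open Set

/-- Height of a cluster: infimum of the height function over the cluster. -/
noncomputable def clusterHeight {X : Type*} (h : X → ℝ) (C : Set X) : ℝ :=
  sInf (h '' C)

/-- Points `x` and `x'` are connected at level `lam` in the cluster tree `𝒞`
equipped with height function `h`. -/
def connectedAtLevel {X : Type*} (𝒞 : Set (Set X)) (h : X → ℝ) (lam : ℝ) (x x' : X) : Prop :=
  ∃ C ∈ 𝒞, x ∈ C ∧ x' ∈ C ∧ lam ≤ clusterHeight h C

/-- A set `S` is connected at level `lam`: every pair of its points is. -/
def setConnectedAtLevel {X : Type*} (𝒞 : Set (Set X)) (h : X → ℝ) (lam : ℝ) (S : Set X) : Prop :=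
  ∀ x ∈ S, ∀ x' ∈ S, connectedAtLevel 𝒞 h lam x x'

/-- Sets `S` and `S'` are separated at level `lam`. -/
def separatedAtLevel {X : Type*} (𝒞 : Set (Set X)) (h : X → ℝ) (lam : ℝ) (S S' : Set X) : Prop :=
  ∀ s ∈ S, ∀ s' ∈ S', ¬ connectedAtLevel 𝒞 h lam s s'

/-- Merge height of two points in a cluster tree equipped with a height function. -/
noncomputable def treeMergeHeight {X : Type*} (𝒞 : Set (Set X)) (h : X → ℝ) (x x' : X) : ℝ :=
  sSup {r | ∃ C ∈ 𝒞, x ∈ C ∧ x' ∈ C ∧ r = clusterHeight h C}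

/-- `𝒞` is a cluster tree on the set `Y`: `Y ∈ 𝒞`, all clusters are subsets of `Y`,
and any two clusters are nested or disjoint (laminar family). -/
def IsClusterTreeOn {X : Type*} (Y : Set X) (𝒞 : Set (Set X)) : Prop :=
  Y ∈ 𝒞 ∧ (∀ C ∈ 𝒞, C ⊆ Y) ∧ ∀ C ∈ 𝒞, ∀ C' ∈ 𝒞, C ∩ C' = ∅ ∨ C ⊆ C' ∨ C' ⊆ C

/-- `A` is a connected component of the superlevel set `{y | lam ≤ f y}`. -/
def IsCCOfSuplevel {X : Type*} [TopologicalSpace X] (f : X → ℝ) (lam : ℝ) (A : Set X) : Prop :=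
  ∃ x, lam ≤ f x ∧ A = connectedComponentIn {y | lam ≤ f y} x

/-- Merge height of two points in the density cluster tree of `f`. -/
noncomputable def densityMergeHeight {X : Type*} [TopologicalSpace X] (f : X → ℝ)
    (x x' : X) : ℝ :=
  sSup {lam | x' ∈ connectedComponentIn {y | lam ≤ f y} x}

/-- The merge level `μ = inf_{a ∈ A, b ∈ B} m_f(a,b)` of two sets in the density
cluster tree of `f`. -/
noncomputable def densityMergeOf {X : Type*} [TopologicalSpace X] (f : X → ℝ)
    (A B : Set X) : ℝ :=
  sInf (Set.image2 (densityMergeHeight f) A B)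

theorem clusterHeight_le {X : Type*} {h : X → ℝ} (h0 : ∀ x, 0 ≤ h x) {C : Set X} {x : X}
    (hx : x ∈ C) : clusterHeight h C ≤ h x :=
  csInf_le ⟨0, by rintro _ ⟨y, -, rfl⟩; exact h0 y⟩ (mem_image_of_mem h hx)

theorem connectedAtLevel.le_treeMergeHeight {X : Type*} {𝒞 : Set (Set X)} {h : X → ℝ}
    (h0 : ∀ x, 0 ≤ h x) {r : ℝ} {x y : X} (hr : connectedAtLevel 𝒞 h r x y) :
    r ≤ treeMergeHeight 𝒞 h x y := by
  obtain ⟨C, hC, hx, hy, hrC⟩ := hr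
  refine hrC.trans (le_csSup ⟨h x, ?_⟩ ⟨C, hC, hx, hy, rfl⟩)
  rintro _ ⟨D, -, hxD, -, rfl⟩
  exact clusterHeight_le h0 hxD

theorem connectedAtLevel_of_lt_treeMergeHeight {X : Type*} {Y : Set X} {𝒞 : Set (Set X)}
    {h : X → ℝ} (h𝒞 : IsClusterTreeOn Y 𝒞) {r : ℝ} {x y : X} (hx : x ∈ Y) (hy : y ∈ Y)
    (hr : r < treeMergeHeight 𝒞 h x y) : connectedAtLevel 𝒞 h r x y := by
  have h_ne : {r | ∃ C ∈ 𝒞, x ∈ C ∧ y ∈ C ∧ r = clusterHeight h C}.Nonempty :=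
    ⟨_, Y, h𝒞.1, hx, hy, rfl⟩
  obtain ⟨_, ⟨C, hC, hxC, hyC, rfl⟩, hrC⟩ := exists_lt_of_lt_csSup h_ne hr
  exact ⟨C, hC, hxC, hyC, hrC.le⟩

section Density

variable {X : Type*} [TopologicalSpace X] {f : X → ℝ}

theorem mem_connectedComponentIn_suplevel_anti {r s : ℝ} (hrs : r ≤ s) {x y : X}
    (h : y ∈ connectedComponentIn {z | s ≤ f z} x) :
    y ∈ connectedComponentIn {z | r ≤ f z} x :=
  connectedComponentIn_mono x (fun _ hz => hrs.trans hz) h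

theorem le_densityMergeHeight {r : ℝ} {x y : X}
    (h : y ∈ connectedComponentIn {z | r ≤ f z} x) : r ≤ densityMergeHeight f x y :=
  le_csSup ⟨f x, fun s hs =>
    connectedComponentIn_nonempty_iff (F := {z | s ≤ f z}).1 ⟨y, hs⟩⟩ h

theorem exists_mem_connectedComponentIn_of_lt_densityMergeHeight [ConnectedSpace X]
    (hf0 : ∀ x, 0 ≤ f x) {r : ℝ} {x y : X} (h : r < densityMergeHeight f x y) :
    ∃ s, r < s ∧ y ∈ connectedComponentIn {z | s ≤ f z} x := by
  have h_zero : y ∈ connectedComponentIn {z | 0 ≤ f z} x := by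
    have : {z | 0 ≤ f z} = univ := eq_univ_of_forall hf0
    simp [this, connectedComponentIn_univ, PreconnectedSpace.connectedComponent_eq_univ]
  obtain ⟨s, hs, hrs⟩ := exists_lt_of_lt_csSup ⟨0, h_zero⟩ h
  exact ⟨s, hrs, hs⟩

theorem IsCCOfSuplevel.eq_connectedComponentIn {lam : ℝ} {A : Set X}
    (hA : IsCCOfSuplevel f lam A) {a : X} (ha : a ∈ A) :
    A = connectedComponentIn {z | lam ≤ f z} a := by
  obtain ⟨x, -, rfl⟩ := hA
  exact connectedComponentIn_eq ha

/-- The density merge height of a pair of points in two disjoint components of the same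
superlevel set is at most the merge level of the two components. -/
theorem densityMergeHeight_le_densityMergeOf [ConnectedSpace X] (hf0 : ∀ x, 0 ≤ f x)
    {lam : ℝ} {A A' : Set X} (hA : IsCCOfSuplevel f lam A) (hA' : IsCCOfSuplevel f lam A')
    (hdisj : A ∩ A' = ∅) {s s' : X} (hs : s ∈ A) (hs' : s' ∈ A') :
    densityMergeHeight f s s' ≤ densityMergeOf f A A' := by
  refine le_csInf ⟨_, mem_image2_of_mem hs hs'⟩ ?_
  rintro _ ⟨a, ha, a', ha', rfl⟩
  refine le_of_forall_lt fun r hr => ?_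
  obtain ⟨t, hrt, ht⟩ := exists_mem_connectedComponentIn_of_lt_densityMergeHeight hf0 hr
  have htlam : t < lam := by
    by_contra! h
    have h_mem := mem_connectedComponentIn_suplevel_anti h ht
    rw [← hA.eq_connectedComponentIn hs] at h_mem
    exact (hdisj ▸ (⟨h_mem, hs'⟩ : s' ∈ A ∩ A') : s' ∈ (∅ : Set X))
  have has : s ∈ connectedComponentIn {z | t ≤ f z} a :=
    mem_connectedComponentIn_suplevel_anti htlam.le (hA.eq_connectedComponentIn ha ▸ hs)
  have hsa' : a' ∈ connectedComponentIn {z | t ≤ f z} s' :=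
    mem_connectedComponentIn_suplevel_anti htlam.le (hA'.eq_connectedComponentIn hs' ▸ ha')
  rw [← connectedComponentIn_eq ht, ← connectedComponentIn_eq has] at hsa'
  exact hrt.trans_le (le_densityMergeHeight hsa')

end Density

/-- Convergence in the merge distortion metric implies uniform minimality and
uniform separation. -/
theorem merge_convergence_implies_uniform_min_and_sep {X : Type*} [TopologicalSpace X]
    [ConnectedSpace X] (f : X → ℝ) (hf0 : ∀ x, 0 ≤ f x) (hfbdd : ∃ M, ∀ x, f x ≤ M)
    (Xn : ℕ → Set X) (hXnfin : ∀ n, (Xn n).Finite)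
    (𝒞 : ℕ → Set (Set X)) (h𝒞 : ∀ n, IsClusterTreeOn (Xn n) (𝒞 n))
    -- the merge distortion converges to zero
    (hconv : ∀ ε : ℝ, 0 < ε → ∃ N, ∀ n ≥ N, ∀ x ∈ Xn n, ∀ x' ∈ Xn n,
      |treeMergeHeight (𝒞 n) f x x' - densityMergeHeight f x x'| < ε) :
    -- uniform minimality
    ((∀ δ : ℝ, 0 < δ → ∃ N, ∀ n ≥ N, ∀ lam : ℝ, ∀ A : Set X,
        IsCCOfSuplevel f lam A →
        setConnectedAtLevel (𝒞 n) f (lam - δ) (A ∩ Xn n)) ∧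
    -- uniform separation
     (∀ δ : ℝ, 0 < δ → ∃ N, ∀ n ≥ N, ∀ lam : ℝ, ∀ A A' : Set X,
        IsCCOfSuplevel f lam A → IsCCOfSuplevel f lam A' → A ∩ A' = ∅ →
        separatedAtLevel (𝒞 n) f (densityMergeOf f A A' + δ) (A ∩ Xn n) (A' ∩ Xn n))) := by
  refine ⟨fun δ hδ => ?_, fun δ hδ => ?_⟩
  all_goals
    obtain ⟨N, hN⟩ := hconv δ hδ
    refine ⟨N, fun n hn lam A => ?_⟩
  · rintro hA x ⟨hxA, hx⟩ x' ⟨hxA', hx'⟩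
    have h_conv := abs_lt.1 (hN n hn x hx x' hx')
    have h_le := le_densityMergeHeight (hA.eq_connectedComponentIn hxA ▸ hxA')
    exact connectedAtLevel_of_lt_treeMergeHeight (h𝒞 n) hx hx' (by linarith)
  · rintro A' hA hA' hdisj s ⟨hsA, hs⟩ s' ⟨hsA', hs'⟩ h_conn
    have h_conv := abs_lt.1 (hN n hn s hs s' hs')
    have h_tree := h_conn.le_treeMergeHeight hf0
    have h_le := densityMergeHeight_le_densityMergeOf hf0 hA hA' hdisj hsA hsA'
    linarith
end

section
/- Let X be a connected topological space and let f, f̃ : X → ℝ both be nonnegative and bounded, with δ := sup_{y ∈ X} |f(y) − f̃(y)|. Define the tree distance of the density cluster tree of f by d_f(x, x') := f(x) + f(x') − 2 m_f(x, x'), and similarly d_{f̃}(x, x') := f̃(x) + f̃(x') − 2 m_{f̃}(x, x'). Then for all x, x' ∈ X, |d_f(x, x') − d_{f̃}(x, x')| ≤ 4δ. -/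
open Set

theorem densityMergeHeight_nonempty {X : Type*} [TopologicalSpace X] [ConnectedSpace X]
    {f : X → ℝ} (hf0 : ∀ x, 0 ≤ f x) (x x' : X) :
    {lam | x' ∈ connectedComponentIn {y | lam ≤ f y} x}.Nonempty := by
  refine ⟨0, ?_⟩
  have huniv : {y | 0 ≤ f y} = univ := eq_univ_of_forall hf0
  simp only [mem_ofPred_eq, huniv, connectedComponentIn_univ,
    PreconnectedSpace.connectedComponent_eq_univ, mem_univ]

theorem densityMergeHeight_bddAbove {X : Type*} [TopologicalSpace X] (f : X → ℝ) (x x' : X) :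
    BddAbove {lam | x' ∈ connectedComponentIn {y | lam ≤ f y} x} :=
  ⟨f x', fun lam h => connectedComponentIn_subset {y | lam ≤ f y} x h⟩

theorem densityMergeHeight_le_add {X : Type*} [TopologicalSpace X] [ConnectedSpace X]
    {f g : X → ℝ} (hf0 : ∀ x, 0 ≤ f x) {δ : ℝ} (hδ : ∀ y, f y ≤ g y + δ) (x x' : X) :
    densityMergeHeight f x x' ≤ densityMergeHeight g x x' + δ := by
  refine csSup_le (densityMergeHeight_nonempty hf0 x x') fun lam hlam => ?_
  have hmem : lam - δ ∈ {lam | x' ∈ connectedComponentIn {y | lam ≤ g y} x} :=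
    connectedComponentIn_mono x
      (fun y (hy : lam ≤ f y) => show lam - δ ≤ g y by linarith [hδ y]) hlam
  have hle : lam - δ ≤ densityMergeHeight g x x' :=
    le_csSup (densityMergeHeight_bddAbove g x x') hmem
  linarith

/-- `L∞`-stability of the tree distance `d_f(x,x') = f(x) + f(x') - 2 m_f(x,x')` of the
density cluster tree: if `|f - f̃| ≤ δ` pointwise, then the tree distances differ
by at most `4δ`. -/
theorem density_tree_distance_stability {X : Type*} [TopologicalSpace X] [ConnectedSpace X]
    (f g : X → ℝ)
    (hf0 : ∀ x, 0 ≤ f x) (hfbdd : ∃ M, ∀ x, f x ≤ M)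
    (hg0 : ∀ x, 0 ≤ g x) (hgbdd : ∃ M, ∀ x, g x ≤ M)
    (δ : ℝ) (hδ : ∀ y, |f y - g y| ≤ δ) :
    ∀ x x' : X,
      |(f x + f x' - 2 * densityMergeHeight f x x') -
       (g x + g x' - 2 * densityMergeHeight g x x')| ≤ 4 * δ := by
  intro x x'
  have hfg := densityMergeHeight_le_add hf0
    (fun y => by linarith [(abs_le.mp (hδ y)).2] : ∀ y, f y ≤ g y + δ) x x'
  have hgf := densityMergeHeight_le_add hg0
    (fun y => by linarith [(abs_le.mp (hδ y)).1] : ∀ y, g y ≤ f y + δ) x x'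
  obtain ⟨hx, hx_le⟩ := abs_le.mp (hδ x)
  obtain ⟨hx', hx'_le⟩ := abs_le.mp (hδ x')
  exact abs_le.mpr ⟨by linarith, by linarith⟩
end
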